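/- arXiv:1402.3138 — 2 statements merged into one kernel-verified Lean document; each statement's English description precedes it below -/
import Mathlib

section
/- In the isotropic fully connected network where p_{ik} = ρ/(n-1) for all i ≠ k (with n = |A| ≥ 2 and ρ ∈ [0,1)), the decision share of agent i with endowment w equals ((n-1)/(n-1+ρ)) · ((1-ρ) w_i + (ρ/(n-1)) w^T e). -/
open Matrix

/-- The inverse of a matrix with constant diagonal `1` and constant off-diagonal entry `-a`. -/
theorem inv_one_sub_of_const_off_diag {ι K : Type*} [Fintype ι] [DecidableEq ι] [Field K]
    {a : K} (ha : 1 + a ≠ 0) (hb : 1 + a - Fintype.card ι * a ≠ 0)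
    {P : Matrix ι ι K} (hP : ∀ i k, P i k = if i = k then 0 else a) :
    (1 - P)⁻¹ = Matrix.of fun i k =>
      (1 + a)⁻¹ * ((if i = k then 1 else 0) + a / (1 + a - Fintype.card ι * a)) := by
  have hentry : ∀ i k, (1 - P) i k = (1 + a) * (if i = k then 1 else 0) - a := by
    intro i k
    rw [Matrix.sub_apply, hP, Matrix.one_apply]
    split_ifs <;> ring
  apply Matrix.inv_eq_right_inv
  ext i k
  simp only [Matrix.mul_apply, hentry, Matrix.of_apply, Matrix.one_apply]
  simp only [mul_add, sub_mul, mul_ite, mul_one, mul_zero, ite_mul, zero_mul,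
    Finset.sum_add_distrib, Finset.sum_sub_distrib, Finset.sum_ite_eq, Finset.sum_ite_eq',
    Finset.mem_univ, if_true, Finset.sum_const, Finset.card_univ, nsmul_eq_mul]
  generalize hd : 1 + a - Fintype.card ι * a = d at hb ⊢
  have hcard : (Fintype.card ι : K) * a = 1 + a - d := by rw [← hd]; ring
  split_ifs <;> field_simp <;> linear_combination -a * hcard

/-- In the isotropic fully connected network, with
`P i k = ρ/(n-1)` for `i ≠ k` and zero diagonal, `n ≥ 2`, `ρ ∈ [0,1)`,
the decision share of agent `i` with endowment `w` equals
`((n-1)/(n-1+ρ)) * ((1-ρ) w i + (ρ/(n-1)) wᵀe)`. -/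
theorem decision_share_isotropic_network {n : ℕ} (hn : 2 ≤ n)
    (ρ : ℝ) (hρ0 : 0 ≤ ρ) (hρ1 : ρ < 1)
    (w : Fin n → ℝ) (hw : ∀ i, 0 ≤ w i)
    (P : Matrix (Fin n) (Fin n) ℝ)
    (hP : ∀ i k, P i k = if i = k then 0 else ρ / ((n : ℝ) - 1)) :
    ∀ i, (w ᵥ* (1 - P)⁻¹) i * (1 - ∑ k, P i k) =
      (((n : ℝ) - 1) / ((n : ℝ) - 1 + ρ)) *
        ((1 - ρ) * w i + (ρ / ((n : ℝ) - 1)) * ∑ k, w k) := by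
  intro i
  have hn' : (0 : ℝ) < n - 1 := by
    have : (2 : ℝ) ≤ n := by exact_mod_cast hn
    linarith
  have hdiag : 1 + ρ / ((n : ℝ) - 1) ≠ 0 := by positivity
  have hrow : 1 + ρ / ((n : ℝ) - 1) - n * (ρ / ((n : ℝ) - 1)) = 1 - ρ := by
    field_simp
    ring
  have hρ : 1 - ρ ≠ 0 := by linarith
  have hsum : ∑ k, P i k = ρ := by
    have hP' : ∀ k, P i k = ρ / ((n : ℝ) - 1) - if i = k then ρ / ((n : ℝ) - 1) else 0 := by
      intro k
      rw [hP]
      split_ifs <;> ring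
    simp only [hP', Finset.sum_sub_distrib, Finset.sum_ite_eq, Finset.mem_univ, if_true,
      Finset.sum_const, Finset.card_univ, Fintype.card_fin, nsmul_eq_mul]
    linarith
  have hvec : (w ᵥ* (1 - P)⁻¹) i =
      (1 + ρ / ((n : ℝ) - 1))⁻¹ * (w i + ρ / ((n : ℝ) - 1) / (1 - ρ) * ∑ k, w k) := by
    rw [inv_one_sub_of_const_off_diag hdiag (by rwa [Fintype.card_fin, hrow]) hP,
      Fintype.card_fin, hrow]
    simp only [Matrix.vecMul, dotProduct, Matrix.of_apply, mul_left_comm (w _), mul_add,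
      mul_ite, mul_one, mul_zero, Finset.sum_add_distrib, Finset.sum_ite_eq',
      Finset.mem_univ, if_true, Finset.mul_sum]
    simp only [mul_comm (w _)]
  have hinv : (1 + ρ / ((n : ℝ) - 1))⁻¹ = ((n : ℝ) - 1) / ((n : ℝ) - 1 + ρ) := by
    field_simp
  rw [hvec, hsum, hinv]
  field_simp
end

section
/- Concavity of profit: if π : S → R is nonnegative, increasing, concave, and twice differentiable on an interval S = [L, U] with U ≤ m, then the profit function Π(z) = (m - z) π(z) is concave on S. -/
/-- Concavity of profit: if the choice share `π` is nonnegative,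
increasing, concave and twice differentiable on `S = [L, U]` with `U ≤ m`
(`m > 0` the base margin), then the profit `Π(z) = (m - z) π(z)` is concave
on `S`. -/
theorem profit_concave (L U m : ℝ) (hm : 0 < m) (hU : U ≤ m)
    (π : ℝ → ℝ)
    (hnonneg : ∀ z ∈ Set.Icc L U, 0 ≤ π z)
    (hmono : MonotoneOn π (Set.Icc L U))
    (hccv : ConcaveOn ℝ (Set.Icc L U) π)
    (hdiff : ContDiffOn ℝ 2 π (Set.Icc L U)) :
    ConcaveOn ℝ (Set.Icc L U) (fun z => (m - z) * π z) := by
  have hmargin : ConcaveOn ℝ (Set.Icc L U) (fun z => m - z) :=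
    (concaveOn_const m hccv.1).sub (convexOn_id hccv.1)
  refine hmargin.mul hccv (fun z hz => sub_nonneg.2 (hz.2.trans hU)) (fun z hz => hnonneg z hz) ?_
  have hanti : AntitoneOn (fun z => m - z) (Set.Icc L U) :=
    fun _ _ _ _ h => sub_le_sub_left h m
  exact hanti.antivaryOn hmono
end
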